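/- Let Φ : [−a,a] → ℝ be convex and continuous, h : [0,T] → ℝ continuous, and define J(v) = ∫₀^T [Φ(v'(t)) + h(t) v(t)] dt on the set W ∩ K of zero-mean T-periodic Lipschitz functions v with ‖v'‖_∞ ≤ a. Then J attains its minimum on W ∩ K, i.e. there exists w̃ ∈ W ∩ K with J(w̃) = inf_{v ∈ W ∩ K} J(v). -/

import Mathlib

open Set MeasureTheory Filter

open scoped Topology NNReal

/-- The Lipschitz functions on a compact interval bounded by `B` form a compact set for uniform
convergence. -/
lemma isCompact_setOf_lipschitzWith_of_abs_le {X : Type*} [PseudoMetricSpace X]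
    (K : ℝ≥0) (B : ℝ) :
    IsCompact {f : C(X, ℝ) | LipschitzWith K f ∧ ∀ x, |f x| ≤ B} := by
  apply ArzelaAscoli.isCompact_of_equicontinuous
  · have himage : ContinuousMap.toFun '' {f : C(X, ℝ) | LipschitzWith K f ∧ ∀ x, |f x| ≤ B} =
        {f : X → ℝ | LipschitzWith K f} ∩ Set.pi univ fun _ => Icc (-B) B := by
      ext f
      constructor
      · rintro ⟨g, ⟨hg, hB⟩, rfl⟩
        exact ⟨hg, fun x _ => abs_le.mp (hB x)⟩
      · rintro ⟨hf, hB⟩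
        exact ⟨⟨f, hf.continuous⟩, ⟨hf, fun x => abs_le.mpr (hB x trivial)⟩, rfl⟩
    rw [himage]
    refine (isCompact_univ_pi fun _ => isCompact_Icc).inter_left ?_
    simp only [lipschitzWith_iff_dist_le_mul, Set.ofPred_forall]
    refine isClosed_iInter fun x => isClosed_iInter fun y => ?_
    exact isClosed_le (by fun_prop) continuous_const
  · exact (LipschitzWith.uniformEquicontinuous _ K fun f => f.2.1).equicontinuous

/-- A Lipschitz function with zero mean on an interval is bounded there. -/
lemma abs_le_of_lipschitzOnWith_of_integral_eq_zero {T : ℝ} (hT : 0 < T) {K : ℝ≥0} {v : ℝ → ℝ}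
    (hv : LipschitzOnWith K v (Icc 0 T)) (hint : ∫ t in (0:ℝ)..T, v t = 0)
    {x : ℝ} (hx : x ∈ Icc 0 T) : |v x| ≤ K * T := by
  have hvi : IntervalIntegrable v volume 0 T :=
    ContinuousOn.intervalIntegrable (by rw [uIcc_of_le hT.le]; exact hv.continuousOn)
  have hbound : ‖∫ t in (0:ℝ)..T, (v x - v t)‖ ≤ K * T * |T - 0| := by
    refine intervalIntegral.norm_integral_le_of_norm_le_const fun t ht => ?_
    rw [uIoc_of_le hT.le] at ht
    have hd := hv.dist_le_mul x hx t (Ioc_subset_Icc_self ht)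
    rw [← dist_eq_norm]
    refine hd.trans (mul_le_mul_of_nonneg_left ?_ K.2)
    rw [Real.dist_eq, abs_le]
    constructor <;> linarith [hx.1, hx.2, ht.1, ht.2]
  rw [intervalIntegral.integral_sub (by simp) hvi, hint] at hbound
  simp only [intervalIntegral.integral_const, sub_zero, smul_eq_mul, Real.norm_eq_abs, abs_mul,
    abs_of_pos hT] at hbound
  exact le_of_mul_le_mul_left (by linarith) hT

/-- A bounded continuous function of the derivative is integrable on bounded intervals. -/
lemma intervalIntegrable_comp_deriv {Ψ : ℝ → ℝ} (hΨ : Continuous Ψ) {C : ℝ} (hC : ∀ x, |Ψ x| ≤ C)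
    (g : ℝ → ℝ) (x y : ℝ) : IntervalIntegrable (fun t => Ψ (deriv g t)) volume x y := by
  refine (intervalIntegrable_const (c := C)).mono_fun
    (hΨ.measurable.comp (measurable_deriv g)).aestronglyMeasurable (ae_of_all _ fun t => ?_)
  exact (hC _).trans (le_abs_self C)

/-- Jensen's inequality for the difference quotient of a Lipschitz function. -/
lemma mul_convexOn_slope_le_integral_comp_deriv {Ψ : ℝ → ℝ} (hΨ : Continuous Ψ) {C : ℝ}
    (hC : ∀ x, |Ψ x| ≤ C) {K : ℝ≥0} (hconv : ConvexOn ℝ (Icc (-(K : ℝ)) K) Ψ) {g : ℝ → ℝ}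
    (hg : LipschitzWith K g) {δ : ℝ} (hδ : 0 < δ) (t : ℝ) :
    δ * Ψ (δ⁻¹ * (g (t + δ) - g t)) ≤ ∫ s in t..t + δ, Ψ (deriv g s) := by
  have hac : AbsolutelyContinuousOnInterval g t (t + δ) :=
    (hg.lipschitzOnWith).absolutelyContinuousOnInterval
  have hle : t ≤ t + δ := by linarith
  have hj := hconv.map_set_average_le (μ := volume) (t := Ioc t (t + δ)) (f := deriv g)
    hΨ.continuousOn isClosed_Icc (by simp [hδ]) (by simp)
    (ae_of_all _ fun x => abs_le.mp (norm_deriv_le_of_lipschitz hg))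
    ((intervalIntegrable_iff_integrableOn_Ioc_of_le hle).mp hac.intervalIntegrable_deriv)
    ((intervalIntegrable_iff_integrableOn_Ioc_of_le hle).mp
      (intervalIntegrable_comp_deriv hΨ hC g _ _))
  rw [← uIoc_of_le hle, interval_average_eq, interval_average_eq, hac.integral_deriv_eq_sub] at hj
  simp only [add_sub_cancel_left, smul_eq_mul] at hj
  calc _ ≤ δ * (δ⁻¹ * ∫ s in t..t + δ, Ψ (deriv g s)) := mul_le_mul_of_nonneg_left hj hδ.le
    _ = _ := by field_simp

/-- Replacing the derivative by a difference quotient increases a convex integral functional by at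
most a multiple of the step. -/
lemma integral_convexOn_slope_le {Ψ : ℝ → ℝ} (hΨ : Continuous Ψ) {C : ℝ}
    (hC : ∀ x, |Ψ x| ≤ C) {K : ℝ≥0} (hconv : ConvexOn ℝ (Icc (-(K : ℝ)) K) Ψ) {g : ℝ → ℝ}
    (hg : LipschitzWith K g) {δ : ℝ} (hδ : 0 < δ) {T : ℝ} (hT : 0 ≤ T) :
    ∫ t in (0:ℝ)..T, Ψ (δ⁻¹ * (g (t + δ) - g t)) ≤
      (∫ t in (0:ℝ)..T, Ψ (deriv g t)) + 2 * C * δ := by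
  have hgc := hg.continuous
  have hi := intervalIntegrable_comp_deriv hΨ hC g
  let G : ℝ → ℝ := fun x => ∫ s in (0:ℝ)..x, Ψ (deriv g s)
  have hGc : Continuous G := intervalIntegral.continuous_primitive hi 0
  have hGi : ∀ x y, IntervalIntegrable G volume x y := fun x y => hGc.intervalIntegrable x y
  have hGlip : ∀ x y, x ≤ y → |G y - G x| ≤ C * (y - x) := by
    intro x y hxy
    rw [intervalIntegral.integral_interval_sub_left (hi _ _) (hi _ _)]
    have := intervalIntegral.norm_integral_le_of_norm_le_const
      (a := x) (b := y) (f := fun t => Ψ (deriv g t)) (C := C) fun t _ => hC _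
    rwa [abs_of_nonneg (sub_nonneg.mpr hxy)] at this
  have hC0 : 0 ≤ C := (abs_nonneg _).trans (hC 0)
  have hstep : δ * ∫ t in (0:ℝ)..T, Ψ (δ⁻¹ * (g (t + δ) - g t)) ≤
      ∫ t in (0:ℝ)..T, (G (t + δ) - G t) := by
    rw [← intervalIntegral.integral_const_mul]
    refine intervalIntegral.integral_mono_on hT ?_ ?_ fun t _ => ?_
    · exact Continuous.intervalIntegrable (by fun_prop) _ _
    · exact Continuous.intervalIntegrable (by fun_prop) _ _
    · rw [intervalIntegral.integral_interval_sub_left (hi _ _) (hi _ _)]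
      exact mul_convexOn_slope_le_integral_comp_deriv hΨ hC hconv hg hδ t
  have hshift : ∫ t in (0:ℝ)..T, (G (t + δ) - G t) =
      (∫ t in T..T + δ, G t) - ∫ t in (0:ℝ)..δ, G t := by
    rw [intervalIntegral.integral_sub (Continuous.intervalIntegrable (by fun_prop) _ _) (hGi _ _),
      intervalIntegral.integral_comp_add_right, zero_add]
    have h₁ := intervalIntegral.integral_add_adjacent_intervals (hGi 0 δ) (hGi δ (T + δ))
    have h₂ := intervalIntegral.integral_add_adjacent_intervals (hGi 0 T) (hGi T (T + δ))
    linarith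
  have hupper : ∫ t in T..T + δ, G t ≤ δ * (G T + C * δ) := by
    have := intervalIntegral.integral_mono_on (b := T + δ) (by linarith) (hGi T (T + δ))
      (intervalIntegrable_const (c := G T + C * δ)) fun t ht => by
        have h₁ := (abs_le.mp (hGlip T t ht.1)).2
        have h₂ : C * (t - T) ≤ C * δ := mul_le_mul_of_nonneg_left (by linarith [ht.2]) hC0
        linarith
    simpa only [intervalIntegral.integral_const, add_sub_cancel_left, smul_eq_mul] using this
  have hlower : δ * (-(C * δ)) ≤ ∫ t in (0:ℝ)..δ, G t := by
    have := intervalIntegral.integral_mono_on hδ.le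
      (intervalIntegrable_const (c := -(C * δ))) (hGi 0 δ) fun t ht => by
        have h₁ := (abs_le.mp (hGlip 0 t ht.1)).1
        have h₂ : C * (t - 0) ≤ C * δ := mul_le_mul_of_nonneg_left (by linarith [ht.2]) hC0
        have h₃ : G 0 = 0 := intervalIntegral.integral_same
        linarith
    simpa only [intervalIntegral.integral_const, sub_zero, smul_eq_mul] using this
  refine le_of_mul_le_mul_left ?_ hδ
  calc _ ≤ _ := hstep
    _ = _ := hshift
    _ ≤ δ * (G T + C * δ) - δ * (-(C * δ)) := sub_le_sub hupper hlower
    _ = δ * (G T + 2 * C * δ) := by ring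

/-- Integral functionals of difference quotients converge to those of the derivative. -/
lemma tendsto_integral_comp_slope {Ψ : ℝ → ℝ} (hΨ : Continuous Ψ) {C : ℝ}
    (hC : ∀ x, |Ψ x| ≤ C) {K : ℝ≥0} {g : ℝ → ℝ} (hg : LipschitzWith K g) (x y : ℝ) :
    Tendsto (fun δ : ℝ => ∫ t in x..y, Ψ (δ⁻¹ * (g (t + δ) - g t))) (𝓝[>] 0)
      (𝓝 (∫ t in x..y, Ψ (deriv g t))) := by
  have hgc := hg.continuous
  refine intervalIntegral.tendsto_integral_filter_of_dominated_convergence (fun _ => C)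
    (Eventually.of_forall fun δ => Continuous.aestronglyMeasurable (by fun_prop))
    (Eventually.of_forall fun δ => ae_of_all _ fun t _ => hC _) intervalIntegrable_const ?_
  filter_upwards [hg.ae_differentiableAt_real] with t ht _
  exact (hΨ.tendsto _).comp (by simpa using ht.hasDerivAt.tendsto_slope_zero_right)

/-- A convex integral functional of the derivative is lower semicontinuous for uniform convergence
among functions with a common Lipschitz constant. -/
lemma lowerSemicontinuousOn_integral_comp_deriv {T : ℝ} (hT : 0 ≤ T) {Ψ : ℝ → ℝ}
    (hΨ : Continuous Ψ) {C : ℝ} (hC : ∀ x, |Ψ x| ≤ C) {K : ℝ≥0}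
    (hconv : ConvexOn ℝ (Icc (-(K : ℝ)) K) Ψ) :
    LowerSemicontinuousOn
      (fun f : C(Icc (0:ℝ) T, ℝ) => ∫ t in (0:ℝ)..T, Ψ (deriv (IccExtend hT f) t))
      {f | LipschitzWith K f} := by
  have hext : ∀ f : C(Icc (0:ℝ) T, ℝ), LipschitzWith K f → LipschitzWith K (IccExtend hT f) :=
    fun f hf => by simpa [IccExtend] using hf.comp (LipschitzWith.projIcc hT)
  intro f hf y hy
  have hlim : Tendsto (fun δ : ℝ => (∫ t in (0:ℝ)..T,
      Ψ (δ⁻¹ * (IccExtend hT f (t + δ) - IccExtend hT f t))) - 2 * C * δ) (𝓝[>] 0)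
      (𝓝 ((∫ t in (0:ℝ)..T, Ψ (deriv (IccExtend hT f) t)) - 2 * C * 0)) :=
    (tendsto_integral_comp_slope hΨ hC (hext f hf) 0 T).sub
      ((tendsto_id.mono_left nhdsWithin_le_nhds).const_mul _)
  rw [mul_zero, sub_zero] at hlim
  obtain ⟨δ, hyδ, hδ⟩ := ((hlim.eventually_const_lt hy).and self_mem_nhdsWithin).exists
  have hcont : Continuous fun u : C(Icc (0:ℝ) T, ℝ) => (∫ t in (0:ℝ)..T,
      Ψ (δ⁻¹ * (IccExtend hT u (t + δ) - IccExtend hT u t))) - 2 * C * δ := by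
    refine Continuous.sub ?_ continuous_const
    apply intervalIntegral.continuous_parametric_intervalIntegral_of_continuous'
    simp only [Function.uncurry_def, IccExtend, Function.comp_apply]
    have hp : Continuous (projIcc 0 T hT) := continuous_projIcc
    fun_prop
  filter_upwards [(hcont.tendsto f).eventually_const_lt hyδ |>.filter_mono nhdsWithin_le_nhds,
    self_mem_nhdsWithin] with u hu hulip
  linarith [integral_convexOn_slope_le hΨ hC hconv (hext u hulip) hδ hT]

/-- Functions agreeing on `[0, T]` have the same integral functional. -/
lemma integral_comp_deriv_add_mul_congr {T a : ℝ} (hT : 0 ≤ T) (ha : 0 ≤ a) {Φ Ψ h v g : ℝ → ℝ}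
    (hΦΨ : EqOn Φ Ψ (Icc (-a) a)) (hg : LipschitzOnWith (Real.toNNReal a) g (Icc 0 T))
    (hvg : EqOn v g (Icc 0 T)) :
    ∫ t in (0:ℝ)..T, (Φ (deriv v t) + h t * v t) =
      ∫ t in (0:ℝ)..T, (Ψ (deriv g t) + h t * g t) := by
  rw [intervalIntegral.integral_of_le hT, intervalIntegral.integral_of_le hT,
    integral_Ioc_eq_integral_Ioo, integral_Ioc_eq_integral_Ioo]
  refine setIntegral_congr_fun measurableSet_Ioo fun t ht => ?_
  have hmem : Icc (0:ℝ) T ∈ 𝓝 t := Icc_mem_nhds ht.1 ht.2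
  have hd : deriv v t = deriv g t :=
    Filter.EventuallyEq.deriv_eq (hvg.eventuallyEq_of_mem hmem)
  have hb := norm_deriv_le_of_lipschitzOn hmem hg
  rw [Real.coe_toNNReal _ ha] at hb
  simp only [hd, hvg (Ioo_subset_Icc_self ht), hΦΨ (abs_le.mp hb)]

/-- The functional `J(v) = ∫₀^T [Φ(v') + h v] dt`, with `Φ` convex and continuous on
`[−a,a]` and `h` continuous, attains its minimum on the set `W ∩ K` of zero-mean
`T`-periodic Lipschitz functions with Lipschitz constant at most `a`. -/
theorem stmt6 (T a : ℝ) (hT : 0 < T) (ha : 0 < a)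
    (Φ h : ℝ → ℝ)
    (hΦconv : ConvexOn ℝ (Set.Icc (-a) a) Φ)
    (hΦcont : ContinuousOn Φ (Set.Icc (-a) a))
    (hh : Continuous h) :
    ∃ w : ℝ → ℝ,
      (LipschitzOnWith (Real.toNNReal a) w (Set.Icc 0 T) ∧ w 0 = w T ∧
        (∫ t in (0:ℝ)..T, w t) = 0) ∧
      ∀ v : ℝ → ℝ,
        LipschitzOnWith (Real.toNNReal a) v (Set.Icc 0 T) → v 0 = v T →
        (∫ t in (0:ℝ)..T, v t) = 0 →
        (∫ t in (0:ℝ)..T, (Φ (deriv w t) + h t * w t)) ≤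
          ∫ t in (0:ℝ)..T, (Φ (deriv v t) + h t * v t) := by
  have haa : -a ≤ a := by linarith
  have hT' := hT.le
  have hKa : ((Real.toNNReal a : ℝ≥0) : ℝ) = a := Real.coe_toNNReal _ ha.le
  let Ψ : ℝ → ℝ := IccExtend haa (domRestrict (Icc (-a) a) Φ)
  have hΨ : Continuous Ψ := hΦcont.domRestrict.Icc_extend'
  have hΦΨ : EqOn Φ Ψ (Icc (-a) a) := fun x hx => by simp [Ψ, IccExtend_of_mem haa _ hx]
  obtain ⟨C, hC⟩ : ∃ C, ∀ x, |Ψ x| ≤ C := by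
    obtain ⟨C, hC⟩ := isCompact_Icc.exists_bound_of_continuousOn hΦcont
    exact ⟨C, fun x => hC _ (projIcc (-a) a haa x).2⟩
  have hconv : ConvexOn ℝ (Icc (-((Real.toNNReal a : ℝ≥0) : ℝ)) (Real.toNNReal a : ℝ≥0)) Ψ := by
    rw [hKa]
    exact hΦconv.congr hΦΨ
  have hp : Continuous (projIcc 0 T hT') := continuous_projIcc
  have hmean : Continuous fun f : C(Icc (0:ℝ) T, ℝ) => ∫ t in (0:ℝ)..T, IccExtend hT' f t := by
    apply intervalIntegral.continuous_parametric_intervalIntegral_of_continuous'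
    simp only [Function.uncurry_def, IccExtend, Function.comp_apply]
    fun_prop
  have hlin : Continuous fun f : C(Icc (0:ℝ) T, ℝ) =>
      ∫ t in (0:ℝ)..T, h t * IccExtend hT' f t := by
    apply intervalIntegral.continuous_parametric_intervalIntegral_of_continuous'
    simp only [Function.uncurry_def, IccExtend, Function.comp_apply]
    fun_prop
  let S : Set C(Icc (0:ℝ) T, ℝ) :=
    {f | LipschitzWith (Real.toNNReal a) f ∧ ∀ x, |f x| ≤ (Real.toNNReal a : ℝ≥0) * T} ∩
      ({f | f ⟨0, left_mem_Icc.mpr hT'⟩ = f ⟨T, right_mem_Icc.mpr hT'⟩} ∩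
        {f | ∫ t in (0:ℝ)..T, IccExtend hT' f t = 0})
  have hScomp : IsCompact S :=
    (isCompact_setOf_lipschitzWith_of_abs_le _ _).inter_right
      ((isClosed_eq (by fun_prop) (by fun_prop)).inter (isClosed_eq hmean continuous_const))
  have hSne : S.Nonempty := by
    refine ⟨0, ⟨LipschitzWith.const' 0, fun x => ?_⟩, rfl, ?_⟩
    · simpa using mul_nonneg (Real.toNNReal a).2 hT'
    · simp [IccExtend]
  have hlsc : LowerSemicontinuousOn (fun f : C(Icc (0:ℝ) T, ℝ) =>
      (∫ t in (0:ℝ)..T, Ψ (deriv (IccExtend hT' f) t)) +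
        ∫ t in (0:ℝ)..T, h t * IccExtend hT' f t) S :=
    ((lowerSemicontinuousOn_integral_comp_deriv hT' hΨ hC hconv).mono fun f hf => hf.1.1).add
      (hlin.lowerSemicontinuous.lowerSemicontinuousOn S)
  have hsplit : ∀ f : C(Icc (0:ℝ) T, ℝ),
      ∫ t in (0:ℝ)..T, (Ψ (deriv (IccExtend hT' f) t) + h t * IccExtend hT' f t) =
        (∫ t in (0:ℝ)..T, Ψ (deriv (IccExtend hT' f) t)) +
          ∫ t in (0:ℝ)..T, h t * IccExtend hT' f t := fun f =>
    intervalIntegral.integral_add (intervalIntegrable_comp_deriv hΨ hC _ _ _)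
      ((hh.mul f.continuous.Icc_extend').intervalIntegrable _ _)
  have hext : ∀ f ∈ S, LipschitzOnWith (Real.toNNReal a) (IccExtend hT' f) (Icc 0 T) := by
    intro f hf
    have := hf.1.1.comp (LipschitzWith.projIcc hT')
    rw [mul_one] at this
    exact this.lipschitzOnWith
  obtain ⟨w, hwS, hw⟩ := hlsc.exists_isMinOn hSne hScomp
  refine ⟨IccExtend hT' w, ⟨hext w hwS, ?_, hwS.2.2⟩, fun v hv hv0 hvint => ?_⟩
  · simpa [IccExtend_left, IccExtend_right] using hwS.2.1
  have hvlip : LipschitzWith (Real.toNNReal a) (domRestrict (Icc 0 T) v) := hv.to_restrict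
  let f : C(Icc (0:ℝ) T, ℝ) := ⟨domRestrict (Icc 0 T) v, hvlip.continuous⟩
  have hvf : EqOn v (IccExtend hT' f) (Icc 0 T) := fun x hx => by
    simp [f, IccExtend_of_mem hT' _ hx]
  have hfS : f ∈ S := by
    refine ⟨⟨hvlip, fun x => ?_⟩, hv0, ?_⟩
    · exact abs_le_of_lipschitzOnWith_of_integral_eq_zero hT hv hvint x.2
    · refine Eq.trans (intervalIntegral.integral_congr fun t ht => (hvf ?_).symm) hvint
      rwa [uIcc_of_le hT'] at ht
  rw [integral_comp_deriv_add_mul_congr hT' ha.le hΦΨ (hext w hwS) (eqOn_refl _ _),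
    integral_comp_deriv_add_mul_congr hT' ha.le hΦΨ (hext f hfS) hvf, hsplit, hsplit]
  exact hw hfS
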